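/- Let n ≥ 1. There exists a constant C₀ = C₀(n) > 0 such that for every C ≥ C₀, every R ≥ 1, every t ∈ [0, R], and all x, y ∈ ℝⁿ with |x| ≤ 2√R and |y| ≤ 2√R, the function F(t,x,y) = (1 + it/(CR))^{-n} exp( −(|x|² + |y|²)/(2(CR + it)) ) satisfies Re F(t,x,y) ≥ 1/2. -/

import Mathlib

noncomputable section

abbrev E (n : ℕ) : Type := EuclideanSpace ℝ (Fin n)

/-- The vertical tube solution
F(t,x,y) = (1 + it/(CR))^{-n} exp(−(|x|²+|y|²)/(2(CR+it))). -/
def F (n : ℕ) (C R t : ℝ) (x y : E n) : ℂ :=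
  (1 + Complex.I * (t : ℂ) / ((C * R : ℝ) : ℂ)) ^ (-(n : ℤ)) *
    Complex.exp (-(((‖x‖ ^ 2 + ‖y‖ ^ 2 : ℝ)) : ℂ) /
      (2 * (((C * R : ℝ) : ℂ) + Complex.I * (t : ℂ))))

/-- For C large (depending only on n), the vertical tube solution has real part at least
1/2 on the region 0 ≤ t ≤ R, |x| ≤ 2√R, |y| ≤ 2√R. -/
theorem tube_real_part_lower_bound (n : ℕ) (hn : 1 ≤ n) :
    ∃ C₀ > (0:ℝ), ∀ C ≥ C₀, ∀ R ≥ (1:ℝ), ∀ t : ℝ, 0 ≤ t → t ≤ R →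
      ∀ x y : E n, ‖x‖ ≤ 2 * Real.sqrt R → ‖y‖ ≤ 2 * Real.sqrt R →
        (1/2 : ℝ) ≤ (F n C R t x y).re := by
  have hc : ContinuousAt (fun p : ℂ × ℂ => ((1 + p.1) ^ (-(n : ℤ)) * Complex.exp p.2).re) (0, 0) := by
    have h1 : ContinuousAt (fun p : ℂ × ℂ => (1 + p.1) ^ (-(n : ℤ))) (0, 0) := by
      apply ContinuousAt.zpow₀
      · fun_prop
      · left; simp
    have h2 : ContinuousAt (fun p : ℂ × ℂ => Complex.exp p.2) (0, 0) := by fun_prop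
    exact Complex.continuous_re.continuousAt.comp (h1.mul h2)
  have hev := hc.eventually (lt_mem_nhds (a := (1/2 : ℝ)) (by simp; norm_num))
  obtain ⟨δ, hδ, hball⟩ := Metric.eventually_nhds_iff.1 hev
  refine ⟨5 / δ, by positivity, ?_⟩
  intro C hC R hR t ht htR x y hx hy
  have hC0 : 0 < C := lt_of_lt_of_le (by positivity) hC
  have hR0 : 0 < R := by linarith
  have hCR : 0 < C * R := by positivity
  have h5 : 5 ≤ C * δ := (div_le_iff₀ hδ).1 hC
  have hsq : Real.sqrt R ^ 2 = R := Real.sq_sqrt hR0.le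
  have hx2 : ‖x‖ ^ 2 ≤ 4 * R := by
    have := pow_le_pow_left₀ (norm_nonneg x) hx 2
    rw [mul_pow, hsq] at this; linarith
  have hy2 : ‖y‖ ^ 2 ≤ 4 * R := by
    have := pow_le_pow_left₀ (norm_nonneg y) hy 2
    rw [mul_pow, hsq] at this; linarith
  have h5R : 5 * R ≤ δ * (C * R) := by nlinarith
  have hz : ‖Complex.I * (t : ℂ) / ((C * R : ℝ) : ℂ)‖ < δ := by
    rw [norm_div, norm_mul, Complex.norm_I, Complex.norm_real, Complex.norm_real,
      Real.norm_of_nonneg ht, Real.norm_of_nonneg hCR.le, div_lt_iff₀ hCR]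
    linarith
  have hden : C * R ≤ ‖((C * R : ℝ) : ℂ) + Complex.I * (t : ℂ)‖ := by
    have h := Complex.re_le_norm (((C * R : ℝ) : ℂ) + Complex.I * (t : ℂ))
    rw [Complex.add_re, Complex.ofReal_re, Complex.re_mul_ofReal, Complex.I_re] at h
    linarith
  have hw : ‖-(((‖x‖ ^ 2 + ‖y‖ ^ 2 : ℝ)) : ℂ) /
      (2 * (((C * R : ℝ) : ℂ) + Complex.I * (t : ℂ)))‖ < δ := by
    rw [norm_div, norm_neg, norm_mul, Complex.norm_real, Real.norm_of_nonneg (by positivity),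
      Complex.norm_two, div_lt_iff₀ (by linarith)]
    have := mul_le_mul_of_nonneg_left hden hδ.le
    linarith
  have key := @hball (Complex.I * (t : ℂ) / ((C * R : ℝ) : ℂ),
    -(((‖x‖ ^ 2 + ‖y‖ ^ 2 : ℝ)) : ℂ) / (2 * (((C * R : ℝ) : ℂ) + Complex.I * (t : ℂ))))
    (by rw [Prod.dist_eq, dist_zero_right, dist_zero_right]; exact max_lt hz hw)
  exact key.le

end
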